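/- arXiv:1903.04703 — 4 statements merged into one kernel-verified Lean document; each statement's English description precedes it below -/
import Mathlib

section
/- Let K be a nonempty compact metric space, let a, b : K → ℝ be continuous, and let γ be the standard Gaussian measure on ℝ (mean 0, variance 1). Suppose there is no point x* ∈ K such that a(x*) + b(x*)·w ≤ a(x) + b(x)·w for every x ∈ K and every w ∈ ℝ (i.e., no single point minimizes x ↦ a(x) + b(x)·w simultaneously for all w). Then ∫ min_{x ∈ K} (a(x) + b(x)·w) dγ(w) < min_{x ∈ K} a(x); equivalently, the value of information min_{x ∈ K} a(x) − ∫ min_{x ∈ K} (a(x) + b(x)·w) dγ(w) is strictly positive. -/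
open MeasureTheory ProbabilityTheory

lemma integral_lt_integral_of_le_of_measure_lt_ne_zero {α : Type*} [MeasurableSpace α]
    {μ : Measure α} {f g : α → ℝ} (hf : Integrable f μ) (hg : Integrable g μ)
    (hle : ∀ x, f x ≤ g x) (hlt : μ {x | f x < g x} ≠ 0) :
    ∫ x, f x ∂μ < ∫ x, g x ∂μ := by
  rw [← sub_pos, ← integral_sub hg hf,
    integral_pos_iff_support_of_nonneg (fun x => sub_nonneg.2 (hle x)) (hg.sub hf)]
  exact pos_iff_ne_zero.2 (mt (measure_mono_null fun x hx => (sub_pos.2 hx.out).ne') hlt)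

lemma continuous_iInf_affine {K : Type*} [TopologicalSpace K] [CompactSpace K]
    {a b : K → ℝ} (ha : Continuous a) (hb : Continuous b) :
    Continuous fun w : ℝ => ⨅ x : K, (a x + b x * w) := by
  have hc : Continuous fun w : ℝ => sInf ((fun x => a x + b x * w) '' Set.univ) :=
    isCompact_univ.continuous_sInf (f := fun w x => a x + b x * w) (by fun_prop)
  simpa only [Set.image_univ, sInf_range] using hc

lemma bddBelow_range_affine {K : Type*} [TopologicalSpace K] [CompactSpace K]
    {a b : K → ℝ} (ha : Continuous a) (hb : Continuous b) (w : ℝ) :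
    BddBelow (Set.range fun x => a x + b x * w) :=
  (isCompact_range (by fun_prop)).bddBelow

lemma integrable_affine_gaussianReal (c d : ℝ) :
    Integrable (fun w => c + d * w) (gaussianReal 0 1) :=
  (integrable_const c).add (((memLp_id_gaussianReal 1).integrable (by simp)).const_mul d)

lemma integral_affine_gaussianReal (c d : ℝ) :
    ∫ w, (c + d * w) ∂(gaussianReal 0 1) = c := by
  have hid : Integrable (fun w : ℝ => w) (gaussianReal 0 1) :=
    (memLp_id_gaussianReal 1).integrable (by simp)
  rw [integral_add (integrable_const c) (hid.const_mul d), integral_const_mul,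
    integral_id_gaussianReal]
  simp

lemma integrable_iInf_affine_gaussianReal {K : Type*} [TopologicalSpace K] [CompactSpace K]
    [Nonempty K] {a b : K → ℝ} (ha : Continuous a) (hb : Continuous b) :
    Integrable (fun w => ⨅ x : K, (a x + b x * w)) (gaussianReal 0 1) := by
  obtain ⟨A, hA⟩ := isCompact_univ.exists_bound_of_continuousOn ha.continuousOn
  obtain ⟨B, hB⟩ := isCompact_univ.exists_bound_of_continuousOn hb.continuousOn
  have hbound : Integrable (fun w : ℝ => A + B * |w|) (gaussianReal 0 1) :=
    (integrable_const A).add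
      (((memLp_id_gaussianReal 1).integrable (by simp)).abs.const_mul B)
  refine hbound.mono' (continuous_iInf_affine ha hb).aestronglyMeasurable
    (Filter.Eventually.of_forall fun w => ?_)
  have hx : ∀ x, |a x + b x * w| ≤ A + B * |w| := fun x =>
    calc |a x + b x * w| ≤ |a x| + |b x| * |w| := by
          rw [← abs_mul]; exact abs_add_le _ _
      _ ≤ A + B * |w| := by
          gcongr
          · exact hA x trivial
          · exact hB x trivial
  let x₀ := Classical.arbitrary K
  exact abs_le.2 ⟨le_ciInf fun x => (abs_le.1 (hx x)).1,
    (ciInf_le (bddBelow_range_affine ha hb w) x₀).trans (abs_le.1 (hx x₀)).2⟩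

/-- Proposition 1 (core): strict positivity of the value of information of a single
evaluation. If no single point `x*` minimizes `x ↦ a x + b x * w` simultaneously for
every `w`, then the Gaussian expectation of the minimum is strictly below the minimum
of `a`. -/
theorem stmt_0 {K : Type*} [MetricSpace K] [CompactSpace K] [Nonempty K]
    (a b : K → ℝ) (ha : Continuous a) (hb : Continuous b)
    (h : ¬ ∃ x0 : K, ∀ (x : K) (w : ℝ), a x0 + b x0 * w ≤ a x + b x * w) :
    ∫ w, (⨅ x : K, (a x + b x * w)) ∂(gaussianReal 0 1) < ⨅ x : K, a x := by
  obtain ⟨x₀, -, hx₀⟩ := isCompact_univ.exists_isMinOn Set.univ_nonempty ha.continuousOn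
  push Not at h
  obtain ⟨x₁, w₁, hlt⟩ := h x₀
  have hle : ∀ w x, ⨅ x : K, (a x + b x * w) ≤ a x + b x * w := fun w x =>
    ciInf_le (bddBelow_range_affine ha hb w) x
  calc ∫ w, (⨅ x : K, (a x + b x * w)) ∂(gaussianReal 0 1)
      < ∫ w, (a x₀ + b x₀ * w) ∂(gaussianReal 0 1) := by
        refine integral_lt_integral_of_le_of_measure_lt_ne_zero
          (integrable_iInf_affine_gaussianReal ha hb) (integrable_affine_gaussianReal _ _)
          (fun w => hle w x₀) fun hzero => ?_
        have hopen : IsOpen {w : ℝ | a x₁ + b x₁ * w < a x₀ + b x₀ * w} :=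
          isOpen_lt (by fun_prop) (by fun_prop)
        refine (hopen.measure_pos volume ⟨w₁, hlt⟩).ne' ?_
        exact gaussianReal_absolutelyContinuous' 0 one_ne_zero
          (measure_mono_null (fun w hw => (hle w x₁).trans_lt hw) hzero)
    _ = a x₀ := integral_affine_gaussianReal _ _
    _ ≤ ⨅ x : K, a x := le_ciInf fun x => hx₀ (Set.mem_univ x)
end

section
/- Let K ⊆ ℝ^d be nonempty and compact, let U ⊆ ℝ^p be open, let μ : K → ℝ be continuous, and let σ̃ : K × U → ℝ^q be continuous such that for each x ∈ K the map z ↦ σ̃(x, z) is differentiable on U and the derivative (x, z) ↦ D_z σ̃(x, z) is jointly continuous on K × U. Let γ_q be the standard Gaussian measure on ℝ^q. Fix z₀ ∈ U and a function x* : ℝ^q → K such that for γ_q-almost every w, x*(w) is the unique minimizer over K of x ↦ μ(x) + ⟨σ̃(x, z₀), w⟩. Define L(z) = ∫ min_{x ∈ K} (μ(x) + ⟨σ̃(x, z), w⟩) dγ_q(w). Then L is differentiable at z₀, and its differential is the linear map v ↦ ∫ ⟨(D_z σ̃(x*(w), z₀)) v, w⟩ dγ_q(w). -/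
open MeasureTheory ProbabilityTheory

open Set Filter Topology Metric

/-- Uniformly close functions have close infima. -/
lemma abs_sInf_image_sub_sInf_image_le {α : Type*} {s : Set α} (hs : s.Nonempty) {f g : α → ℝ}
    (hf : BddBelow (f '' s)) (hg : BddBelow (g '' s)) {ε : ℝ} (h : ∀ x ∈ s, |f x - g x| ≤ ε) :
    |sInf (f '' s) - sInf (g '' s)| ≤ ε := by
  have key : ∀ {f g : α → ℝ}, BddBelow (f '' s) → (∀ x ∈ s, |f x - g x| ≤ ε) →
      sInf (f '' s) - ε ≤ sInf (g '' s) := by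
    intro f g hf h
    refine le_csInf (hs.image g) ?_
    rintro _ ⟨x, hx, rfl⟩
    have h1 := csInf_le hf (mem_image_of_mem f hx)
    have h2 := (abs_le.1 (h x hx)).2
    linarith
  have h1 := key hf h
  have h2 := key hg fun x hx => (abs_sub_comm (g x) (f x)).trans_le (h x hx)
  rw [abs_le]
  constructor <;> linarith

/-- Danskin's theorem: a minimum over a compact set is differentiable wherever the minimizer is
unique. -/
lemma hasFDerivAt_sInf_image {X E : Type*} [TopologicalSpace X] [NormedAddCommGroup E]
    [NormedSpace ℝ E] {K : Set X} (hK : IsCompact K) {f : X → E → ℝ} {x₀ : X} (hx₀ : x₀ ∈ K)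
    {z₀ : E} (hf : ContinuousOn (fun x => f x z₀) K)
    (hmin : ∀ x ∈ K, x ≠ x₀ → f x₀ z₀ < f x z₀)
    (hunif : TendstoUniformlyOn (fun z x => f x z) (fun x => f x z₀) (𝓝 z₀) K)
    {D : E →L[ℝ] ℝ}
    (hD : ∀ ε > 0, ∀ᶠ xz in 𝓝[K] x₀ ×ˢ 𝓝 z₀,
      |f xz.1 xz.2 - f xz.1 z₀ - D (xz.2 - z₀)| ≤ ε * ‖xz.2 - z₀‖) :
    HasFDerivAt (fun z => sInf ((fun x => f x z) '' K)) D z₀ := by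
  have hmin' : ∀ x ∈ K, f x₀ z₀ ≤ f x z₀ := fun x hx => by
    by_cases h : x = x₀
    · rw [h]
    · exact (hmin x hx h).le
  have hval : sInf ((fun x => f x z₀) '' K) = f x₀ z₀ :=
    IsLeast.csInf_eq ⟨mem_image_of_mem _ hx₀, by rintro _ ⟨x, hx, rfl⟩; exact hmin' x hx⟩
  rw [hasFDerivAt_iff_isLittleO, Asymptotics.isLittleO_iff]
  intro ε hε
  obtain ⟨P, hP, Q, hQ, hPQ⟩ := eventually_prod_iff.1 (hD ε hε)
  obtain ⟨O, hO, hx₀O, hOP⟩ := mem_nhdsWithin.1 hP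
  have hgap : ∃ η > 0, ∀ x ∈ K, x ∉ O → f x₀ z₀ + η ≤ f x z₀ := by
    rcases (K \ O).eq_empty_or_nonempty with he | hne
    · exact ⟨1, one_pos, fun x hx hxO => (he.subset ⟨hx, hxO⟩).elim⟩
    · obtain ⟨y, hy, hymin⟩ := (hK.diff hO).exists_isMinOn hne (hf.mono sdiff_subset)
      have hlt := hmin y hy.1 (by rintro rfl; exact hy.2 hx₀O)
      refine ⟨f y z₀ - f x₀ z₀, sub_pos.2 hlt, fun x hx hxO => ?_⟩
      have : f y z₀ ≤ f x z₀ := hymin ⟨hx, hxO⟩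
      linarith
  obtain ⟨η, hη, hgap⟩ := hgap
  have hDsmall : ∀ᶠ z in 𝓝 z₀, |D (z - z₀)| < η / 2 := by
    have : Tendsto (fun z => |D (z - z₀)|) (𝓝 z₀) (𝓝 0) := by
      have hc : Continuous fun z => |D (z - z₀)| := by fun_prop
      simpa using hc.tendsto z₀
    exact this.eventually (gt_mem_nhds (by positivity))
  filter_upwards [hQ, hDsmall, Metric.tendstoUniformlyOn_iff.1 hunif (η / 2) (by positivity)]
    with z hz hDz hu
  have hlow : ∀ x ∈ K, f x₀ z₀ + D (z - z₀) - ε * ‖z - z₀‖ ≤ f x z := by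
    intro x hx
    by_cases hxO : x ∈ O
    · have h1 := (abs_le.1 (hPQ (hOP ⟨hxO, hx⟩) hz)).1
      have h2 := hmin' x hx
      dsimp only at h1
      linarith
    · have h1 := hgap x hx hxO
      have h2 := (abs_lt.1 (Real.dist_eq _ _ ▸ hu x hx)).2
      have h3 := (abs_lt.1 hDz).2
      have h4 : 0 ≤ ε * ‖z - z₀‖ := by positivity
      linarith
  have hge : f x₀ z₀ + D (z - z₀) - ε * ‖z - z₀‖ ≤ sInf ((fun x => f x z) '' K) :=
    le_csInf ⟨_, mem_image_of_mem _ hx₀⟩ (by rintro _ ⟨x, hx, rfl⟩; exact hlow x hx)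
  have hle : sInf ((fun x => f x z) '' K) ≤ f x₀ z :=
    csInf_le ⟨_, by rintro _ ⟨x, hx, rfl⟩; exact hlow x hx⟩ (mem_image_of_mem _ hx₀)
  have hup := (abs_le.1 (hPQ (hOP ⟨hx₀O, hx₀⟩) hz)).2
  dsimp only at hup
  rw [hval, Real.norm_eq_abs, abs_le]
  constructor <;> linarith

/-- First-order expansion that is uniform in a parameter, from joint continuity of the partial
derivative. -/
lemma eventually_norm_sub_sub_fderiv_le {X E F : Type*} [TopologicalSpace X]
    [NormedAddCommGroup E] [NormedSpace ℝ E] [NormedAddCommGroup F] [NormedSpace ℝ F]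
    {K : Set X} {U : Set E} (hU : IsOpen U) {σ : X → E → F}
    (hσd : ∀ x ∈ K, ∀ z ∈ U, DifferentiableAt ℝ (σ x) z)
    (hDc : ContinuousOn (fun xz : X × E => fderiv ℝ (σ xz.1) xz.2) (K ×ˢ U))
    {x₀ : X} (hx₀ : x₀ ∈ K) {z₀ : E} (hz₀ : z₀ ∈ U) {ε : ℝ} (hε : 0 < ε) :
    ∀ᶠ xz in 𝓝[K] x₀ ×ˢ 𝓝 z₀,
      ‖σ xz.1 xz.2 - σ xz.1 z₀ - fderiv ℝ (σ x₀) z₀ (xz.2 - z₀)‖ ≤ ε * ‖xz.2 - z₀‖ := by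
  have hcont := Metric.tendsto_nhds.1 (hDc (x₀, z₀) ⟨hx₀, hz₀⟩) ε hε
  rw [nhdsWithin_prod_eq, hU.nhdsWithin_eq hz₀] at hcont
  obtain ⟨P, hP, Q, hQ, hPQ⟩ := eventually_prod_iff.1 hcont
  obtain ⟨r, hr, hrQ⟩ := Metric.eventually_nhds_iff_ball.1 (hQ.and (hU.mem_nhds hz₀))
  refine eventually_prod_iff.2 ⟨fun x => P x ∧ x ∈ K, hP.and self_mem_nhdsWithin,
    fun z => z ∈ ball z₀ r, ball_mem_nhds z₀ hr, fun {x} hx {z} hz => ?_⟩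
  refine (convex_ball z₀ r).norm_image_sub_le_of_norm_fderiv_le' (𝕜 := ℝ)
    (fun y hy => hσd x hx.2 y (hrQ y hy).2) (fun y hy => ?_) (mem_ball_self hr) hz
  rw [← dist_eq_norm]
  exact (hPQ hx.1 (hrQ y hy).1).le

/-- An almost everywhere derivative of measurable functions is measurable. -/
lemma aestronglyMeasurable_of_hasFDerivAt {Ω : Type*} [MeasurableSpace Ω] {P : Measure Ω}
    {p : ℕ} {F : (Fin p → ℝ) → Ω → ℝ} {F' : Ω → (Fin p → ℝ) →L[ℝ] ℝ} {z₀ : Fin p → ℝ}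
    (hF : ∀ᶠ z in 𝓝 z₀, AEStronglyMeasurable (F z) P)
    (hF' : ∀ᵐ w ∂P, HasFDerivAt (F · w) (F' w) z₀) : AEStronglyMeasurable F' P := by
  have happ : ∀ v, AEStronglyMeasurable (fun w => F' w v) P := by
    intro v
    have hlim : Tendsto (fun n : ℕ => z₀ + (n : ℝ)⁻¹ • v) atTop (𝓝 z₀) := by
      simpa using ((tendsto_inv_atTop_nhds_zero_nat (𝕜 := ℝ)).smul_const v).const_add z₀
    obtain ⟨N, hN⟩ := eventually_atTop.1 (hlim.eventually hF)
    refine aestronglyMeasurable_of_tendsto_ae atTop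
      (f := fun (n : ℕ) w => ((n + N : ℕ) : ℝ) • (F (z₀ + ((n + N : ℕ) : ℝ)⁻¹ • v) w - F z₀ w))
      (fun n => AEStronglyMeasurable.const_smul
        ((hN (n + N) (Nat.le_add_left N n)).sub hF.self_of_nhds) ((n + N : ℕ) : ℝ)) ?_
    filter_upwards [hF'] with w hw
    refine hw.lim v ?_
    simp only [RCLike.norm_natCast]
    exact tendsto_natCast_atTop_atTop.comp (tendsto_add_atTop_nat N)
  have hsum : F' = fun w => ∑ j, F' w (Pi.single j 1) • ContinuousLinearMap.proj j := by
    ext w v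
    conv_lhs => rw [pi_eq_sum_univ' v]
    simp [mul_comm]
  rw [hsum]
  exact Finset.aestronglyMeasurable_fun_sum _ fun j _ => (happ _).smul_const _

/-- The linear form `u ↦ ∑ i, u i * w i`. -/
noncomputable def dotCLM {q : ℕ} (w : Fin q → ℝ) : (Fin q → ℝ) →L[ℝ] ℝ :=
  ∑ i, w i • ContinuousLinearMap.proj i

lemma dotCLM_apply {q : ℕ} (w u : Fin q → ℝ) : dotCLM w u = ∑ i, u i * w i := by
  simp [dotCLM, mul_comm]

lemma dotCLM_comm {q : ℕ} (w u : Fin q → ℝ) : dotCLM w u = dotCLM u w := by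
  simp [dotCLM_apply, mul_comm]

lemma abs_dotCLM_le {q : ℕ} (w u : Fin q → ℝ) : |dotCLM w u| ≤ ‖u‖ * ∑ i, |w i| := by
  rw [dotCLM_apply, Finset.mul_sum]
  refine (Finset.abs_sum_le_sum_abs _ _).trans (Finset.sum_le_sum fun i _ => ?_)
  rw [abs_mul]
  gcongr
  exact norm_le_pi_norm u i

/-- Theorem 1 of the paper: unbiased stochastic gradient of the expected-loss function.
`L z = ∫ min_{x ∈ K} (μf x + ⟨σ x z, w⟩) dγ_q(w)` is differentiable at `z₀`, with
differential `v ↦ ∫ ⟨(D_z σ (x* w) z₀) v, w⟩ dγ_q(w)`, where `x* w` is the a.s.-unique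
minimizer at `z₀`. -/
theorem stmt_4 {d p q : ℕ}
    (K : Set (Fin d → ℝ)) (hKne : K.Nonempty) (hKc : IsCompact K)
    (U : Set (Fin p → ℝ)) (hU : IsOpen U)
    (μf : (Fin d → ℝ) → ℝ) (hμ : ContinuousOn μf K)
    (σ : (Fin d → ℝ) → (Fin p → ℝ) → (Fin q → ℝ))
    (hσc : ContinuousOn (fun xz : (Fin d → ℝ) × (Fin p → ℝ) => σ xz.1 xz.2) (K ×ˢ U))
    (hσd : ∀ x ∈ K, ∀ z ∈ U, DifferentiableAt ℝ (σ x) z)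
    (hDc : ContinuousOn (fun xz : (Fin d → ℝ) × (Fin p → ℝ) => fderiv ℝ (σ xz.1) xz.2)
      (K ×ˢ U))
    (z₀ : Fin p → ℝ) (hz₀ : z₀ ∈ U)
    (xstar : (Fin q → ℝ) → (Fin d → ℝ))
    (hxstar : ∀ᵐ w ∂(Measure.pi fun _ : Fin q => gaussianReal 0 1),
      xstar w ∈ K ∧ ∀ x ∈ K, x ≠ xstar w →
        μf (xstar w) + ∑ i, σ (xstar w) z₀ i * w i < μf x + ∑ i, σ x z₀ i * w i)
    (L : (Fin p → ℝ) → ℝ)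
    (hL : ∀ z, L z =
      ∫ w, sInf ((fun x => μf x + ∑ i, σ x z i * w i) '' K)
        ∂(Measure.pi fun _ : Fin q => gaussianReal 0 1)) :
    ∃ D : (Fin p → ℝ) →L[ℝ] ℝ,
      (∀ v, D v =
        ∫ w, ∑ i, (fderiv ℝ (σ (xstar w)) z₀ v) i * w i
          ∂(Measure.pi fun _ : Fin q => gaussianReal 0 1)) ∧
      HasFDerivAt L D z₀ := by
  simp only [← dotCLM_apply] at hxstar hL ⊢
  set γ : Measure (Fin q → ℝ) := Measure.pi fun _ => gaussianReal 0 1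
  obtain ⟨r, hr, hrU⟩ := Metric.nhds_basis_closedBall.mem_iff.1 (hU.mem_nhds hz₀)
  have hz₀B : z₀ ∈ closedBall z₀ r := mem_closedBall_self hr.le
  have hKB : IsCompact (K ×ˢ closedBall z₀ r) := hKc.prod (isCompact_closedBall z₀ r)
  have hKBU : K ×ˢ closedBall z₀ r ⊆ K ×ˢ U := prod_mono_right hrU
  obtain ⟨M, hM⟩ := hKB.exists_bound_of_continuousOn (hσc.mono hKBU)
  obtain ⟨C, hC⟩ := hKB.exists_bound_of_continuousOn (hDc.mono hKBU)
  obtain ⟨m, hm⟩ := hKc.exists_bound_of_continuousOn hμ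
  obtain ⟨x₁, hx₁⟩ := hKne
  have hC0 : 0 ≤ C := (norm_nonneg _).trans (hC (x₁, z₀) ⟨hx₁, hz₀B⟩)
  set f : (Fin q → ℝ) → (Fin d → ℝ) → (Fin p → ℝ) → ℝ :=
    fun w x z => μf x + dotCLM w (σ x z) with hf
  set F : (Fin p → ℝ) → (Fin q → ℝ) → ℝ := fun z w => sInf ((fun x => f w x z) '' K)
  set S : (Fin q → ℝ) → ℝ := fun w => ∑ i, |w i| with hS
  have hS0 : ∀ w, 0 ≤ S w := fun w => Finset.sum_nonneg fun i _ => abs_nonneg _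
  have hfbound : ∀ w, ∀ z ∈ closedBall z₀ r, ∀ x ∈ K, |f w x z| ≤ m + M * S w := by
    intro w z hz x hx
    refine (abs_add_le _ _).trans (add_le_add (hm x hx) ((abs_dotCLM_le _ _).trans ?_))
    exact mul_le_mul_of_nonneg_right (hM (x, z) ⟨hx, hz⟩) (hS0 w)
  have hbdd : ∀ w, ∀ z ∈ closedBall z₀ r, BddBelow ((fun x => f w x z) '' K) := by
    rintro w z hz
    refine ⟨-(m + M * S w), ?_⟩
    rintro _ ⟨x, hx, rfl⟩
    exact (abs_le.1 (hfbound w z hz x hx)).1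
  have hflip : ∀ w, ∀ z ∈ closedBall z₀ r, ∀ z' ∈ closedBall z₀ r, ∀ x ∈ K,
      |f w x z - f w x z'| ≤ C * S w * ‖z - z'‖ := by
    intro w z hz z' hz' x hx
    have h1 : f w x z - f w x z' = dotCLM w (σ x z - σ x z') := by
      simp only [hf, map_sub]
      ring
    have h2 : ‖σ x z - σ x z'‖ ≤ C * ‖z - z'‖ :=
      (convex_closedBall z₀ r).norm_image_sub_le_of_norm_fderiv_le (𝕜 := ℝ)
        (fun y hy => hσd x hx y (hrU hy)) (fun y hy => hC (x, y) ⟨hx, hy⟩) hz' hz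
    rw [h1, mul_right_comm]
    exact (abs_dotCLM_le _ _).trans (mul_le_mul_of_nonneg_right h2 (hS0 w))
  have hFmeas : ∀ z ∈ closedBall z₀ r, AEStronglyMeasurable (F z) γ := by
    intro z hz
    refine Continuous.aestronglyMeasurable (continuous_iff_continuousAt.2 fun w₀ => ?_)
    have hlim : Tendsto (fun w => M * S (w - w₀)) (𝓝 w₀) (𝓝 0) := by
      have hc : Continuous fun w => M * S (w - w₀) := by
        simp only [hS, Pi.sub_apply]
        fun_prop
      simpa [hS] using hc.tendsto w₀
    refine tendsto_iff_dist_tendsto_zero.2 (squeeze_zero (fun _ => dist_nonneg) (fun w => ?_) hlim)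
    refine abs_sInf_image_sub_sInf_image_le ⟨x₁, hx₁⟩ (hbdd w z hz) (hbdd w₀ z hz) fun x hx => ?_
    have h1 : f w x z - f w₀ x z = dotCLM (w - w₀) (σ x z) := by
      simp only [hf, dotCLM_comm _ (σ x z), map_sub]
      ring
    rw [h1]
    exact (abs_dotCLM_le _ _).trans
      (mul_le_mul_of_nonneg_right (hM (x, z) ⟨hx, hz⟩) (hS0 _))
  have hSint : Integrable S γ := by
    refine integrable_finsetSum _ fun i _ => Integrable.abs ?_
    exact integrable_comp_eval (μ := fun _ : Fin q => gaussianReal 0 1) (i := i)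
      (f := fun t : ℝ => t) ((memLp_id_gaussianReal 1).integrable (by simp))
  have hFint : Integrable (F z₀) γ := by
    refine Integrable.mono' ((integrable_const m).add (hSint.const_mul M)) (hFmeas z₀ hz₀B)
      (Eventually.of_forall fun w => ?_)
    have hconst : (fun _ : Fin d → ℝ => (0 : ℝ)) '' K = {0} := Nonempty.image_const ⟨x₁, hx₁⟩ 0
    have := abs_sInf_image_sub_sInf_image_le (g := fun _ => 0) ⟨x₁, hx₁⟩ (hbdd w z₀ hz₀B)
      (by simp [hconst]) fun x hx => by simpa using hfbound w z₀ hz₀B x hx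
    simpa [hconst] using this
  have hFmeas' : ∀ᶠ z in 𝓝 z₀, AEStronglyMeasurable (F z) γ :=
    eventually_of_mem (closedBall_mem_nhds z₀ hr) hFmeas
  have hFdiff : ∀ᵐ w ∂γ,
      HasFDerivAt (F · w) ((dotCLM w).comp (fderiv ℝ (σ (xstar w)) z₀)) z₀ := by
    filter_upwards [hxstar] with w ⟨hwK, hwmin⟩
    refine hasFDerivAt_sInf_image hKc hwK ?_ hwmin ?_ fun ε hε => ?_
    · exact hμ.add ((dotCLM w).continuous.comp_continuousOn
        (hσc.comp (f := fun x => (x, z₀)) (by fun_prop) fun x hx => ⟨hx, hz₀⟩))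
    · have hlim : Tendsto (fun z => C * S w * ‖z - z₀‖) (𝓝 z₀) (𝓝 0) := by
        have hc : Continuous fun z => C * S w * ‖z - z₀‖ := by fun_prop
        simpa using hc.tendsto z₀
      refine Metric.tendstoUniformlyOn_iff.2 fun ε hε => ?_
      filter_upwards [closedBall_mem_nhds z₀ hr, hlim.eventually (gt_mem_nhds hε)]
        with z hz hzε x hx
      rw [dist_comm]
      exact (hflip w z hz z₀ hz₀B x hx).trans_lt hzε
    · have hS1 : 0 < S w + 1 := by linarith [hS0 w]
      filter_upwards [eventually_norm_sub_sub_fderiv_le hU hσd hDc hwK hz₀ (div_pos hε hS1)]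
        with ⟨x, z⟩ hxz
      have h1 : f w x z - f w x z₀ - (dotCLM w).comp (fderiv ℝ (σ (xstar w)) z₀) (z - z₀)
          = dotCLM w (σ x z - σ x z₀ - fderiv ℝ (σ (xstar w)) z₀ (z - z₀)) := by
        simp only [hf, map_sub, ContinuousLinearMap.comp_apply]
        ring
      refine h1 ▸ (abs_dotCLM_le _ _).trans ?_
      calc _ ≤ ε / (S w + 1) * ‖z - z₀‖ * (S w + 1) :=
            mul_le_mul hxz (by simp [hS]) (hS0 w) (by positivity)
        _ = ε * ‖z - z₀‖ := by field_simp
  have hlip : ∀ᵐ w ∂γ, LipschitzOnWith (Real.nnabs (C * S w)) (F · w) (closedBall z₀ r) := by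
    refine Eventually.of_forall fun w => LipschitzOnWith.of_dist_le_mul fun z hz z' hz' => ?_
    rw [Real.coe_nnabs, abs_of_nonneg (mul_nonneg hC0 (hS0 w)), dist_eq_norm z z']
    exact abs_sInf_image_sub_sInf_image_le ⟨x₁, hx₁⟩ (hbdd w z hz) (hbdd w z' hz')
      (hflip w z hz z' hz')
  obtain ⟨hint, hderiv⟩ := hasFDerivAt_integral_of_dominated_loc_of_lip
    (closedBall_mem_nhds z₀ hr) hFmeas' hFint (aestronglyMeasurable_of_hasFDerivAt hFmeas' hFdiff)
    hlip (hSint.const_mul C) hFdiff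
  exact ⟨_, fun v => ContinuousLinearMap.integral_apply hint v, funext hL ▸ hderiv⟩
end

section
/- Let K be a nonempty compact metric space, let Z ⊆ ℝ^p, let μ : K → ℝ be continuous, and let σ̃ : K × Z → ℝ^q be continuous. Let γ_q be the standard Gaussian measure on ℝ^q. Then the function L : Z → ℝ defined by L(z) = ∫ min_{x ∈ K} (μ(x) + ⟨σ̃(x, z), w⟩) dγ_q(w) is continuous on Z. -/
open MeasureTheory ProbabilityTheory

/-- The infimum over a compact space of a jointly continuous function is continuous in the
remaining variable. -/
theorem continuous_iInf_of_compactSpace {K X : Type*} [TopologicalSpace K] [CompactSpace K]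
    [TopologicalSpace X] {f : X → K → ℝ} (hf : Continuous (Function.uncurry f)) :
    Continuous fun a => ⨅ x, f a x := by
  have h := isCompact_univ.continuous_sInf (K := (Set.univ : Set K)) hf
  simpa only [Set.image_univ, sInf_range] using h

theorem abs_iInf_le_of_forall_abs_le {K : Type*} [Nonempty K] {f : K → ℝ} {B : ℝ}
    (h : ∀ x, |f x| ≤ B) : |⨅ x, f x| ≤ B := by
  have hbdd : BddBelow (Set.range f) := ⟨-B, by rintro _ ⟨x, rfl⟩; exact (abs_le.1 (h x)).1⟩
  obtain ⟨x⟩ := ‹Nonempty K›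
  exact abs_le.2 ⟨le_ciInf fun y => (abs_le.1 (h y)).1,
    (ciInf_le hbdd x).trans (abs_le.1 (h x)).2⟩

/-- Over a compact parameter space, a jointly continuous function is bounded uniformly in the
parameter near each point. -/
theorem exists_eventually_forall_norm_le {K X E : Type*} [TopologicalSpace K] [CompactSpace K]
    [TopologicalSpace X] [SeminormedAddCommGroup E] {f : X → K → E}
    (hf : Continuous (Function.uncurry f)) (a : X) :
    ∃ C : ℝ, ∀ᶠ b in nhds a, ∀ x, ‖f b x‖ ≤ C := by
  have hc : Continuous fun b => ⨅ x, -‖f b x‖ := continuous_iInf_of_compactSpace hf.norm.neg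
  refine ⟨-((⨅ x, -‖f a x‖) - 1), ?_⟩
  filter_upwards [hc.continuousAt.eventually (lt_mem_nhds (sub_one_lt _))] with b hb x
  have hfb : Continuous fun x => -‖f b x‖ := (hf.comp (Continuous.prodMk_right b)).norm.neg
  have := ciInf_le (isCompact_range hfb).bddBelow x
  linarith

theorem integrable_sum_abs_pi_gaussianReal (q : ℕ) :
    Integrable (fun w : Fin q → ℝ => ∑ i, |w i|) (Measure.pi fun _ => gaussianReal 0 1) := by
  refine integrable_finsetSum _ fun i _ => ?_
  have h : Integrable (fun x : ℝ => |x|) (gaussianReal 0 1) :=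
    (IsGaussian.integrable_id (μ := gaussianReal 0 1)).abs
  exact (measurePreserving_eval (fun _ : Fin q => gaussianReal 0 1) i).integrable_comp_of_integrable
    h

/-- Corollary 1 of the paper: the expected-loss function
`L z = ∫ min_{x ∈ K} (μf x + ⟨σ x z, w⟩) dγ_q(w)` is continuous on `Z`. -/
theorem stmt_5 {K : Type*} [MetricSpace K] [CompactSpace K] [Nonempty K] {p q : ℕ}
    (Z : Set (Fin p → ℝ))
    (μf : K → ℝ) (hμ : Continuous μf)
    (σ : K → (Fin p → ℝ) → (Fin q → ℝ))
    (hσ : ContinuousOn (fun xz : K × (Fin p → ℝ) => σ xz.1 xz.2) (Set.univ ×ˢ Z)) :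
    ContinuousOn
      (fun z => ∫ w, (⨅ x : K, (μf x + ∑ i, σ x z i * w i))
        ∂(Measure.pi fun _ : Fin q => gaussianReal 0 1)) Z := by
  have hσZ : Continuous (Function.uncurry fun (z : Z) (x : K) => σ x z) :=
    hσ.comp_continuous (f := fun zx : Z × K => (zx.2, (zx.1 : Fin p → ℝ))) (by fun_prop)
      fun zx => ⟨trivial, zx.1.2⟩
  have hF : Continuous (Function.uncurry fun (zw : Z × (Fin q → ℝ)) (x : K) =>
      μf x + ∑ i, σ x zw.1 i * zw.2 i) := by
    have hσi (i : Fin q) :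
        Continuous fun a : (Z × (Fin q → ℝ)) × K => σ a.2 a.1.1 i :=
      (continuous_apply i).comp
        (hσZ.comp (g := Function.uncurry fun (z : Z) (x : K) => σ x z)
          (f := fun a : (Z × (Fin q → ℝ)) × K => (a.1.1, a.2)) (by fun_prop))
    exact (hμ.comp continuous_snd).add (continuous_finsetSum _ fun i _ =>
      (hσi i).mul ((continuous_apply i).comp (continuous_snd.comp continuous_fst)))
  have hinf := continuous_iInf_of_compactSpace hF
  obtain ⟨M, hM⟩ := isCompact_univ.exists_bound_of_continuousOn hμ.continuousOn
  rw [continuousOn_iff_continuous_domRestrict, continuous_iff_continuousAt]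
  intro z₀
  obtain ⟨C, hC⟩ := exists_eventually_forall_norm_le hσZ z₀
  refine continuousAt_of_dominated (bound := fun w => M + C * ∑ i, |w i|) ?_ ?_ ?_ ?_
  · exact .of_forall fun z => (hinf.comp (Continuous.prodMk_right z)).aestronglyMeasurable
  · filter_upwards [hC] with z hz
    refine .of_forall fun w => abs_iInf_le_of_forall_abs_le fun x => ?_
    refine (abs_add_le _ _).trans (add_le_add (hM x trivial) ?_)
    rw [Finset.mul_sum]
    refine (Finset.abs_sum_le_sum_abs _ _).trans (Finset.sum_le_sum fun i _ => ?_)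
    rw [abs_mul]
    exact mul_le_mul_of_nonneg_right ((norm_le_pi_norm (σ x z) i).trans (hz x)) (abs_nonneg _)
  · exact (integrable_const M).add ((integrable_sum_abs_pi_gaussianReal q).const_mul C)
  · exact .of_forall fun w => (hinf.comp (Continuous.prodMk_left w)).continuousAt
end

section
/- Let K be a nonempty compact metric space, let U ⊆ ℝ^p be open, and let f : U × K → ℝ be continuous such that for each x ∈ K the map z ↦ f(z, x) is differentiable on U and the derivative (z, x) ↦ D_z f(z, x) is jointly continuous on U × K. Define v(z) = min_{x ∈ K} f(z, x). If z₀ ∈ U and x* ∈ K is the unique minimizer of x ↦ f(z₀, x) over K, then v is differentiable at z₀ with derivative D_z f(z₀, x*). -/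
/-- Minimizers of `f (z, ·)` over a compact space stay in a neighbourhood `V` of the unique
minimizer of `f (z₀, ·)` for `z` near `z₀`. -/
theorem eventually_minimizer_mem_of_unique {Z K : Type*} [TopologicalSpace Z]
    [TopologicalSpace K] [CompactSpace K] {f : Z × K → ℝ} {z₀ : Z} {xstar : K}
    (hf : ∀ x, ContinuousAt f (z₀, x))
    (hxstar : ∀ x : K, x ≠ xstar → f (z₀, xstar) < f (z₀, x))
    {V : Set K} (hV : V ∈ nhds xstar) :
    ∀ᶠ z in nhds z₀, ∀ x, f (z, x) ≤ f (z, xstar) → x ∈ V := by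
  have hcompact : IsCompact (interior V)ᶜ := isOpen_interior.isClosed_compl.isCompact
  have htube : ∀ᶠ z in nhds z₀, ∀ x ∈ (interior V)ᶜ, f (z, xstar) < f (z, x) := by
    refine hcompact.eventually_forall_of_forall_eventually fun x hx => ?_
    have hne : x ≠ xstar := by
      rintro rfl
      exact hx (mem_interior_iff_mem_nhds.2 hV)
    have hleft : ContinuousAt (fun q : Z × K => f (q.1, xstar)) (z₀, x) :=
      ContinuousAt.comp (f := fun q : Z × K => (q.1, xstar)) (hf xstar)
        (continuousAt_fst.prodMk continuousAt_const)
    exact hleft.eventually_lt (hf x) (hxstar x hne)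
  filter_upwards [htube] with z hz x hx
  by_contra hxV
  exact absurd (hz x fun h => hxV (interior_subset h)) hx.not_gt

/-- Envelope (Danskin-type) theorem used in the proof of Theorem 1: if `x*` is the
unique minimizer of `x ↦ f (z₀, x)` over the compact set `K`, then the value function
`v z = min_{x ∈ K} f (z, x)` is differentiable at `z₀` with derivative
`D_z f (z₀, x*)`. -/
theorem stmt_6 {K : Type*} [MetricSpace K] [CompactSpace K] [Nonempty K] {p : ℕ}
    (U : Set (Fin p → ℝ)) (hU : IsOpen U)
    (f : (Fin p → ℝ) × K → ℝ)
    (hfc : ContinuousOn f (U ×ˢ Set.univ))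
    (hfd : ∀ x : K, ∀ z ∈ U, DifferentiableAt ℝ (fun z' => f (z', x)) z)
    (hDc : ContinuousOn
      (fun zx : (Fin p → ℝ) × K => fderiv ℝ (fun z' => f (z', zx.2)) zx.1)
      (U ×ˢ Set.univ))
    (z₀ : Fin p → ℝ) (hz₀ : z₀ ∈ U)
    (xstar : K) (hxstar : ∀ x : K, x ≠ xstar → f (z₀, xstar) < f (z₀, x)) :
    HasFDerivAt (fun z => ⨅ x : K, f (z, x))
      (fderiv ℝ (fun z' => f (z', xstar)) z₀) z₀ := by
  have hnhds : ∀ z ∈ U, ∀ x : K, U ×ˢ Set.univ ∈ nhds (z, x) := fun z hz x =>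
    prod_mem_nhds (hU.mem_nhds hz) Filter.univ_mem
  have hfat : ∀ z ∈ U, ∀ x : K, ContinuousAt f (z, x) := fun z hz x =>
    hfc.continuousAt (hnhds z hz x)
  have hmin : ∀ z ∈ U, ∃ y : K, (⨅ x, f (z, x)) = f (z, y) ∧ ∀ x, f (z, y) ≤ f (z, x) := by
    intro z hz
    have hcont : Continuous fun x => f (z, x) := continuous_iff_continuousAt.2 fun x =>
      ContinuousAt.comp (f := fun x : K => (z, x)) (hfat z hz x)
        (continuousAt_const.prodMk continuousAt_id)
    obtain ⟨y, -, hy⟩ := isCompact_univ.exists_isMinOn Set.univ_nonempty hcont.continuousOn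
    have hy' : ∀ x, f (z, y) ≤ f (z, x) := fun x => hy (Set.mem_univ x)
    exact ⟨y, le_antisymm (ciInf_le ⟨f (z, y), Set.forall_mem_range.2 hy'⟩ y)
      (le_ciInf hy'), hy'⟩
  have hv₀ : (⨅ x, f (z₀, x)) = f (z₀, xstar) := by
    obtain ⟨y, hy, hy'⟩ := hmin z₀ hz₀
    have : y = xstar := by
      by_contra hne
      exact absurd (hxstar y hne) (hy' xstar).not_gt
    rw [hy, this]
  rw [hasFDerivAt_iff_isLittleO, Asymptotics.isLittleO_iff]
  intro ε hε
  have hD := (hDc.continuousAt (hnhds z₀ hz₀ xstar)).eventually (Metric.closedBall_mem_nhds _ hε)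
  rw [nhds_prod_eq] at hD
  obtain ⟨P, hP, Q, hQ, hPQ⟩ := Filter.eventually_prod_iff.1 hD
  obtain ⟨r, hr, hball⟩ := Metric.eventually_nhds_iff_ball.1 (hP.and (hU.mem_nhds hz₀))
  have hmvt : ∀ z ∈ Metric.ball z₀ r, ∀ x, Q x →
      |f (z, x) - f (z₀, x) - fderiv ℝ (fun z' => f (z', xstar)) z₀ (z - z₀)|
        ≤ ε * ‖z - z₀‖ := by
    intro z hz x hx
    refine (convex_ball z₀ r).norm_image_sub_le_of_norm_fderiv_le' (𝕜 := ℝ)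
      (f := fun z' => f (z', x)) (fun w hw => hfd x w (hball w hw).2) (fun w hw => ?_)
      (Metric.mem_ball_self hr) hz
    simpa [dist_eq_norm] using hPQ (hball w hw).1 hx
  filter_upwards [Metric.ball_mem_nhds z₀ hr,
    eventually_minimizer_mem_of_unique (hfat z₀ hz₀) hxstar hQ] with z hz hzV
  obtain ⟨y, hy, hy'⟩ := hmin z (hball z hz).2
  have hupper := abs_le.1 (hmvt z hz xstar hQ.self_of_nhds)
  have hlower := abs_le.1 (hmvt z hz y (hzV y (hy' xstar)))
  have hle : f (z₀, xstar) ≤ f (z₀, y) := by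
    rcases eq_or_ne y xstar with rfl | hne
    · exact le_rfl
    · exact (hxstar y hne).le
  rw [hv₀, hy, Real.norm_eq_abs, abs_le]
  constructor <;> linarith [hy' xstar]
end
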